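/- Let F be a forest (a finite simple graph with no cycles) on n ≥ 2 vertices and let v be any vertex of F. Then ξ(F)/ξ(F - v) ≤ 2^((n-3)/2) + 1 if n is odd, and ξ(F)/ξ(F - v) ≤ 2^((n-2)/2) + 1 if n is even, where F - v is the forest obtained by deleting v (and ξ of the empty graph is 1). -/

import Mathlib

open Finset Polynomial

open scoped Classical in
/-- The number of independent vertex sets of size `k` in the graph `G`. -/
noncomputable def indepCount {V : Type*} [Fintype V] (G : SimpleGraph V) (k : ℕ) : ℕ :=
  (Finset.univ.filter fun s : Finset V =>
    s.card = k ∧ ∀ u ∈ s, ∀ v ∈ s, ¬ G.Adj u v).card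

open scoped Classical in
/-- The independence number of `G` : the maximum size of an independent vertex set. -/
noncomputable def indepNum {V : Type*} [Fintype V] (G : SimpleGraph V) : ℕ :=
  (Finset.univ.filter fun s : Finset V => ∀ u ∈ s, ∀ v ∈ s, ¬ G.Adj u v).sup Finset.card

open scoped Classical in
/-- The independence polynomial of `G` (over `ℂ`): `∑_k i_k x^k`, where `i_k` is the
number of independent vertex sets of size `k`. -/
noncomputable def indepPoly {V : Type*} [Fintype V] (G : SimpleGraph V) : Polynomial ℂ :=
  ∑ s ∈ Finset.univ.filter (fun s : Finset V => ∀ u ∈ s, ∀ v ∈ s, ¬ G.Adj u v),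
    (Polynomial.X : Polynomial ℂ) ^ s.card

open scoped Classical in
/-- The independent sets of `G` of size `k` contained in `W`. -/
noncomputable def indepSets {V : Type*} (G : SimpleGraph V) (W : Finset V) (k : ℕ) :
    Finset (Finset V) :=
  W.powerset.filter fun s => s.card = k ∧ ∀ u ∈ s, ∀ v ∈ s, ¬ G.Adj u v

lemma mem_indepSets {V : Type*} {G : SimpleGraph V} {W : Finset V} {k : ℕ} {s : Finset V} :
    s ∈ indepSets G W k ↔ s ⊆ W ∧ s.card = k ∧ ∀ u ∈ s, ∀ v ∈ s, ¬ G.Adj u v := by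
  simp [indepSets]

/-- A finite nonempty forest has a vertex with at most one neighbor. -/
lemma SimpleGraph.IsAcyclic.exists_adj_subsingleton {V : Type*} [Finite V] [Nonempty V]
    {G : SimpleGraph V} (hG : G.IsAcyclic) : ∃ u, ∀ a b, G.Adj u a → G.Adj u b → a = b := by
  obtain ⟨u, v, p, hp, hmax⟩ := SimpleGraph.Walk.exists_isPath_forall_isPath_length_le_length G
  have key : ∀ w, G.Adj u w → w = p.snd := by
    intro w hw
    refine hG.eq_snd_of_adj_start hp hw ?_
    by_contra hsupp
    have := hmax _ _ (SimpleGraph.Walk.cons hw.symm p) (hp.cons hsupp)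
    simp at this
  exact ⟨u, fun a b ha hb => (key a ha).trans (key b hb).symm⟩

lemma SimpleGraph.IsAcyclic.exists_mem_adj_subsingleton {V : Type*} {G : SimpleGraph V}
    (hG : G.IsAcyclic) {W : Finset V} (hW : W.Nonempty) :
    ∃ u ∈ W, ∀ a ∈ W, ∀ b ∈ W, G.Adj u a → G.Adj u b → a = b := by
  have : Nonempty (W : Set V) := hW.to_subtype
  obtain ⟨u, hu⟩ := (hG.induce (W : Set V)).exists_adj_subsingleton
  refine ⟨u, u.2, fun a ha b hb h1 h2 => ?_⟩
  simpa using hu ⟨a, ha⟩ ⟨b, hb⟩ h1 h2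

lemma card_le_card_of_erase_mem {V : Type*} [DecidableEq V] {A B : Finset (Finset V)} (x : V)
    (hx : ∀ s ∈ A, x ∈ s) (hA : ∀ s ∈ A, s.erase x ∈ B) : A.card ≤ B.card := by
  refine Finset.card_le_card_of_injOn (fun s => s.erase x) hA fun s hs t ht hst => ?_
  rw [← Finset.insert_erase (hx s hs), ← Finset.insert_erase (hx t ht)]
  exact congrArg (insert x) hst

/-- A forest on `m` vertices has at most `2 ^ ⌊m / 2⌋` maximum independent sets. -/
lemma card_indepSets_le_two_pow {V : Type*} {G : SimpleGraph V} (hG : G.IsAcyclic) (W : Finset V)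
    (k : ℕ) (hk : ∀ s ⊆ W, (∀ u ∈ s, ∀ v ∈ s, ¬ G.Adj u v) → s.card ≤ k) :
    (indepSets G W k).card ≤ 2 ^ (W.card / 2) := by
  classical
  induction hm : W.card using Nat.strong_induction_on generalizing W k with
  | _ m ih =>
  subst hm
  rcases W.eq_empty_or_nonempty with rfl | hW
  · have : indepSets G ∅ k ⊆ {∅} := fun s hs => by
      simpa using (mem_indepSets.1 hs).1
    simpa using Finset.card_le_card this
  obtain ⟨l, hl, hsub⟩ := hG.exists_mem_adj_subsingleton hW
  have hcardW : (W.erase l).card + 1 = W.card := Finset.card_erase_add_one hl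
  -- an independent set avoiding `l` and its neighbors can be enlarged by `l`
  have hins : ∀ s ⊆ W, (∀ u ∈ s, ∀ v ∈ s, ¬ G.Adj u v) → l ∉ s → (∀ a ∈ s, ¬ G.Adj l a) →
      s.card + 1 ≤ k := by
    intro s hsW hs hls hadj
    rw [← Finset.card_insert_of_notMem hls]
    refine hk _ (Finset.insert_subset hl hsW) ?_
    grind [G.adj_comm, G.irrefl]
  by_cases hiso : ∃ u ∈ W, G.Adj l u
  · obtain ⟨u, hu, hlu⟩ := hiso
    have hul : u ≠ l := hlu.ne'
    have huW : u ∈ W.erase l := Finset.mem_erase.2 ⟨hul, hu⟩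
    set W' := (W.erase l).erase u with hW'
    have hcardW' : W'.card + 1 = (W.erase l).card := Finset.card_erase_add_one huW
    have hadj : ∀ a ∈ W, G.Adj l a → a = u := fun a ha h => hsub a ha u hu h hlu
    have hIH := ih W'.card (by omega) W' (k - 1) (fun s hs hind => by
      have := hins s (by grind) hind (by grind) (by grind)
      omega) rfl
    have h1 : ((indepSets G W k).filter (l ∈ ·)).card ≤ (indepSets G W' (k - 1)).card := by
      refine card_le_card_of_erase_mem l (by grind) fun s hs => ?_
      obtain ⟨hs, hls⟩ := Finset.mem_filter.1 hs
      obtain ⟨h1, h2, h3⟩ := mem_indepSets.1 hs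
      refine mem_indepSets.2 ⟨by grind, by rw [Finset.card_erase_of_mem hls, h2], by grind⟩
    have h2 : ((indepSets G W k).filter (l ∉ ·)).card ≤ (indepSets G W' (k - 1)).card := by
      have hmem : ∀ s ∈ (indepSets G W k).filter (l ∉ ·), u ∈ s := by
        intro s hs
        obtain ⟨hs, hls⟩ := Finset.mem_filter.1 hs
        obtain ⟨h1, h2, h3⟩ := mem_indepSets.1 hs
        by_contra hus
        have := hins s h1 h3 hls (by grind)
        omega
      refine card_le_card_of_erase_mem u hmem fun s hs => ?_
      have hus := hmem s hs
      obtain ⟨hs, hls⟩ := Finset.mem_filter.1 hs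
      obtain ⟨h1, h2, h3⟩ := mem_indepSets.1 hs
      refine mem_indepSets.2 ⟨by grind, by rw [Finset.card_erase_of_mem hus, h2], by grind⟩
    have h3 := Finset.card_filter_add_card_filter_not (s := indepSets G W k) (l ∈ ·)
    have h4 : W.card / 2 = W'.card / 2 + 1 := by omega
    rw [h4, pow_succ]
    omega
  · push Not at hiso
    have hIH := ih (W.erase l).card (by omega) (W.erase l) (k - 1) (fun s hs hind => by
      have := hins s (by grind) hind (by grind) (by grind)
      omega) rfl
    have hmem : ∀ s ∈ indepSets G W k, l ∈ s := by
      intro s hs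
      obtain ⟨h1, h2, h3⟩ := mem_indepSets.1 hs
      by_contra hls
      have := hins s h1 h3 hls (by grind)
      omega
    have h1 : (indepSets G W k).card ≤ (indepSets G (W.erase l) (k - 1)).card := by
      refine card_le_card_of_erase_mem l hmem fun s hs => ?_
      obtain ⟨h1, h2, h3⟩ := mem_indepSets.1 hs
      refine mem_indepSets.2 ⟨by grind, by rw [Finset.card_erase_of_mem (hmem s hs), h2], by grind⟩
    exact h1.trans (hIH.trans (Nat.pow_le_pow_right (by norm_num) (by omega)))

lemma card_le_indepNum {V : Type*} [Fintype V] {G : SimpleGraph V} {s : Finset V}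
    (hs : ∀ u ∈ s, ∀ v ∈ s, ¬ G.Adj u v) : s.card ≤ indepNum G := by
  classical
  exact Finset.le_sup (f := Finset.card) (by simpa using hs)

lemma exists_card_eq_indepNum {V : Type*} [Fintype V] (G : SimpleGraph V) :
    ∃ s : Finset V, s.card = indepNum G ∧ ∀ u ∈ s, ∀ v ∈ s, ¬ G.Adj u v := by
  classical
  obtain ⟨s, hs, h⟩ := Finset.exists_mem_eq_sup
    (Finset.univ.filter fun s : Finset V => ∀ u ∈ s, ∀ v ∈ s, ¬ G.Adj u v) ⟨∅, by simp⟩ Finset.card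
  refine ⟨s, ?_, by simpa using hs⟩
  rw [← h, indepNum]

lemma indepCount_eq_card_indepSets {V : Type*} [Fintype V] (G : SimpleGraph V) (k : ℕ) :
    indepCount G k = (indepSets G Finset.univ k).card := by
  simp only [indepCount, indepSets, Finset.powerset_univ]
  congr!

lemma indepCount_induce {V : Type*} {G : SimpleGraph V} {W : Finset V} {t : Set V} [Fintype t]
    (hW : ∀ x, x ∈ W ↔ x ∈ t) (k : ℕ) :
    indepCount (G.induce t) k = (indepSets G W k).card := by
  classical
  rw [indepCount_eq_card_indepSets]
  refine Finset.card_nbij' (fun s => s.map (Function.Embedding.subtype _))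
    (fun s => s.subtype (· ∈ t)) ?_ ?_ ?_ ?_
  · intro s hs
    obtain ⟨-, h2, h3⟩ := mem_indepSets.1 hs
    refine mem_indepSets.2 ⟨fun x hx => ?_, by simpa using h2, ?_⟩
    · obtain ⟨y, -, rfl⟩ := Finset.mem_map.1 hx
      exact (hW _).2 y.2
    · simpa using h3
  · intro s hs
    obtain ⟨h1, h2, h3⟩ := mem_indepSets.1 hs
    refine mem_indepSets.2 ⟨Finset.subset_univ _, ?_, ?_⟩
    · rw [← h2, Finset.card_subtype, Finset.filter_true_of_mem fun x hx => (hW x).1 (h1 hx)]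
    · intro u hu v hv
      exact h3 _ (Finset.mem_subtype.1 hu) _ (Finset.mem_subtype.1 hv)
  · intro s _
    ext x
    simp
  · intro s hs
    obtain ⟨h1, -, -⟩ := mem_indepSets.1 hs
    simp only [Finset.subtype_map]
    exact Finset.filter_true_of_mem fun x hx => (hW x).1 (h1 hx)

lemma indepCount_indepNum_pos {V : Type*} [Fintype V] (G : SimpleGraph V) :
    0 < indepCount G (indepNum G) := by
  obtain ⟨s, hs⟩ := exists_card_eq_indepNum G
  rw [indepCount_eq_card_indepSets]
  exact Finset.card_pos.2 ⟨s, mem_indepSets.2 ⟨Finset.subset_univ _, hs⟩⟩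

/-- Deleting a vertex `v` from a forest on `n` vertices divides the number of maximum independent
sets by at most `2 ^ ⌊(n - 2) / 2⌋ + 1`. -/
lemma indepCount_le_mul_indepCount_induce {V : Type*} [Fintype V] {F : SimpleGraph V}
    (hF : F.IsAcyclic) (v : V) [Fintype ({x | x ≠ v} : Set V)] :
    indepCount F (indepNum F) ≤
      (2 ^ ((Fintype.card V - 2) / 2) + 1) *
        indepCount (F.induce {x | x ≠ v}) (indepNum (F.induce {x | x ≠ v})) := by
  classical
  set W := Finset.univ.erase v with hWdef
  have hW : ∀ x, x ∈ W ↔ x ∈ ({x | x ≠ v} : Set V) := by simp [W]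
  set H := F.induce {x | x ≠ v}
  set c := indepCount H (indepNum H) with hc
  set A := indepSets F Finset.univ (indepNum F)
  have hcpos : 1 ≤ c := indepCount_indepNum_pos H
  have hcW : c = (indepSets F W (indepNum H)).card := indepCount_induce hW _
  have hmax : ∀ s ⊆ W, (∀ a ∈ s, ∀ b ∈ s, ¬ F.Adj a b) → s.card ≤ indepNum H := by
    intro s hs hind
    have h := card_le_indepNum (G := H) (s := s.subtype (· ∈ ({x | x ≠ v} : Set V)))
      fun a ha b hb => hind _ (Finset.mem_subtype.1 ha) _ (Finset.mem_subtype.1 hb)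
    rwa [Finset.card_subtype, Finset.filter_true_of_mem fun x hx => (hW x).1 (hs hx)] at h
  obtain ⟨t, ht⟩ := Finset.card_pos.1 (hcW ▸ hcpos)
  obtain ⟨htW, htc, htind⟩ := mem_indepSets.1 ht
  have hle : indepNum H ≤ indepNum F := htc ▸ card_le_indepNum htind
  rw [indepCount_eq_card_indepSets]
  change A.card ≤ _
  have hsplit := Finset.card_filter_add_card_filter_not (s := A) (v ∈ ·)
  by_cases hav : ∃ s ∈ A, v ∉ s
  · obtain ⟨s, hs, hvs⟩ := hav
    obtain ⟨-, hsc, hsind⟩ := mem_indepSets.1 hs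
    have heq : indepNum H = indepNum F :=
      le_antisymm hle (hsc ▸ hmax s (by grind) hsind)
    have h1 : (A.filter (v ∉ ·)).card ≤ c := by
      rw [hcW, heq]
      refine Finset.card_le_card fun r hr => ?_
      obtain ⟨hr, hvr⟩ := Finset.mem_filter.1 hr
      obtain ⟨-, hr2, hr3⟩ := mem_indepSets.1 hr
      exact mem_indepSets.2 ⟨by grind, hr2, hr3⟩
    have hins : ∀ r : Finset V, (∀ a ∈ r, ∀ b ∈ r, ¬ F.Adj a b) → v ∉ r →
        (∀ a ∈ r, ¬ F.Adj v a) → r.card + 1 ≤ indepNum F := by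
      intro r hr hvr hadj
      rw [← Finset.card_insert_of_notMem hvr]
      refine card_le_indepNum ?_
      grind [F.adj_comm, F.irrefl]
    have hnbr : ∃ w ∈ s, F.Adj v w := by
      by_contra! hno
      have := hins s hsind hvs hno
      omega
    obtain ⟨w, -, hvw⟩ := hnbr
    set U := W.filter fun x => ¬ F.Adj v x with hU
    have h2 : (A.filter (v ∈ ·)).card ≤ (indepSets F U (indepNum F - 1)).card := by
      refine card_le_card_of_erase_mem v (by grind) fun r hr => ?_
      obtain ⟨hr, hvr⟩ := Finset.mem_filter.1 hr
      obtain ⟨-, hr2, hr3⟩ := mem_indepSets.1 hr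
      refine mem_indepSets.2 ⟨by grind, by rw [Finset.card_erase_of_mem hvr, hr2], by grind⟩
    have h3 : (indepSets F U (indepNum F - 1)).card ≤ 2 ^ (U.card / 2) := by
      refine card_indepSets_le_two_pow hF _ _ fun r hr hind => ?_
      have := hins r hind (by grind) (by grind)
      omega
    have h4 : U.card ≤ Fintype.card V - 2 := by
      have hsub : U ⊆ W.erase w := by grind
      have := Finset.card_le_card hsub
      have hwW : w ∈ W := by simp [W, hvw.ne']
      rw [Finset.card_erase_of_mem hwW, hWdef, Finset.card_erase_of_mem (Finset.mem_univ v),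
        Finset.card_univ] at this
      omega
    have h5 : 2 ^ (U.card / 2) ≤ 2 ^ ((Fintype.card V - 2) / 2) :=
      Nat.pow_le_pow_right (by norm_num) (Nat.div_le_div_right h4)
    nlinarith
  · push Not at hav
    obtain ⟨s, hs1, hs2⟩ := exists_card_eq_indepNum F
    have hs : s ∈ A := mem_indepSets.2 ⟨Finset.subset_univ _, hs1, hs2⟩
    have heq : indepNum H = indepNum F - 1 := by
      have h1 := hmax (s.erase v) (by grind) (by grind)
      rw [Finset.card_erase_of_mem (hav s hs), hs1] at h1
      have h2 : indepNum H ≠ indepNum F := fun h =>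
        (Finset.mem_erase.1 (htW (hav t (mem_indepSets.2
          ⟨Finset.subset_univ _, htc.trans h, htind⟩)))).1 rfl
      omega
    have h1 : A.card ≤ c := by
      rw [hcW, heq]
      refine card_le_card_of_erase_mem v hav fun r hr => ?_
      obtain ⟨-, hr2, hr3⟩ := mem_indepSets.1 hr
      refine mem_indepSets.2 ⟨by grind, by rw [Finset.card_erase_of_mem (hav r hr), hr2], by grind⟩
    exact h1.trans (Nat.le_mul_of_pos_left _ (by positivity))

/-- For a forest `F` on `n ≥ 2` vertices and any vertex `v`,
`ξ(F)/ξ(F - v) ≤ 2^((n-3)/2) + 1` if `n` is odd and `≤ 2^((n-2)/2) + 1` if `n` is even,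
where `ξ(G)` is the number of maximum independent sets of `G`. -/
theorem stmt6 {V : Type*} [Fintype V] [DecidableEq V] {n : ℕ} (hn : 2 ≤ n)
    (hcard : Fintype.card V = n) (F : SimpleGraph V) (hF : F.IsAcyclic) (v : V) :
    (indepCount F (indepNum F) : ℝ) /
        (indepCount (F.induce {x | x ≠ v}) (indepNum (F.induce {x | x ≠ v})) : ℝ) ≤
      if Odd n then (2 : ℝ) ^ (((n : ℝ) - 3) / 2) + 1
      else (2 : ℝ) ^ (((n : ℝ) - 2) / 2) + 1 := by
  have hpos : (0 : ℝ) < indepCount (F.induce {x | x ≠ v}) (indepNum (F.induce {x | x ≠ v})) := by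
    exact_mod_cast indepCount_indepNum_pos _
  have hbound : (if Odd n then (2 : ℝ) ^ (((n : ℝ) - 3) / 2) + 1
      else (2 : ℝ) ^ (((n : ℝ) - 2) / 2) + 1) = (2 : ℝ) ^ ((n - 2) / 2) + 1 := by
    split_ifs with h
    · obtain ⟨m, rfl⟩ := h
      obtain ⟨j, rfl⟩ : ∃ j, m = j + 1 := ⟨m - 1, by omega⟩
      rw [show (2 * (j + 1) + 1 - 2) / 2 = j by omega, ← Real.rpow_natCast]
      push_cast
      ring_nf
    · obtain ⟨m, rfl⟩ := Nat.not_odd_iff_even.1 h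
      obtain ⟨j, rfl⟩ : ∃ j, m = j + 1 := ⟨m - 1, by omega⟩
      rw [show (j + 1 + (j + 1) - 2) / 2 = j by omega, ← Real.rpow_natCast]
      push_cast
      ring_nf
  rw [hbound, div_le_iff₀ hpos]
  subst hcard
  exact_mod_cast indepCount_le_mul_indepCount_induce hF v
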